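/- Let p be an odd prime, let F be a field of characteristic p, and let t ∈ F with t ≠ 0. Let M be the p×p symmetric matrix over F (rows and columns indexed 1,…,p) with M(i,j) = −1 whenever i + j = p − 1 (so 1 ≤ i, j ≤ p − 2), with M(p−1,p) = M(p,p−1) = t, and all other entries 0. Then M is congruent to the diagonal p×p matrix D with D(i,i) = −1 for i odd and D(i,i) = 1 for i even. -/

import Mathlib

open Matrix in
/-- Entries of `Pᵀ * M * P` when the `k`-th column of `P` is `e_{a k} + s k • e_{b k}`. -/
theorem transpose_mul_mul_apply_of_two_term_columns {n R : Type*} [Fintype n] [DecidableEq n]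
    [CommRing R] (M : Matrix n n R) (a b : n → n) (s : n → R) (k l : n) :
    ((Matrix.of fun r k => (if r = a k then 1 else 0) + if r = b k then s k else 0)ᵀ * M *
      Matrix.of fun r k => (if r = a k then 1 else 0) + if r = b k then s k else 0) k l =
    M (a k) (a l) + s l * M (a k) (b l) + s k * M (b k) (a l) + s k * s l * M (b k) (b l) := by
  simp only [mul_apply, transpose_apply, of_apply, add_mul, mul_add, ite_mul, mul_ite, one_mul,
    mul_one, zero_mul, mul_zero, Finset.sum_add_distrib, Finset.sum_ite_eq',
    Finset.mem_univ, if_true]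
  ring


set_option maxHeartbeats 1000000 in
/-- The Gram matrix of the Bézoutian of `((1−p)v^{p−2}, −v^p t − 1)` (the `p×p` symmetric
matrix with `M(i,j) = −1` for `i + j = p − 1`, `M(p−1,p) = M(p,p−1) = t`, and `0` otherwise,
in 1-based indexing) is congruent to the diagonal matrix with entries `−1` in the odd
positions and `1` in the even positions; i.e. the form is `⟨−1⟩ + ((p−1)/2)·h`. -/
theorem bezoutian_saito_infinity_congruent_diagonal (p : ℕ) (hp : p.Prime) (hodd : Odd p)
    (F : Type*) [Field F] [CharP F p] (t : F) (ht : t ≠ 0) :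
    ∃ P : Matrix (Fin p) (Fin p) F, IsUnit P.det ∧
      P.transpose *
        (Matrix.of fun i j : Fin p =>
          if (i.val = p - 2 ∧ j.val = p - 1) ∨ (i.val = p - 1 ∧ j.val = p - 2) then t
          else if i.val + j.val = p - 3 then (-1 : F)
          else 0) * P =
      Matrix.diagonal (fun i : Fin p => if Even i.val then (-1 : F) else 1) := by
  have h2 : (2 : F) ≠ 0 := by
    intro h
    have hdvd : p ∣ 2 := (CharP.cast_eq_zero_iff F p 2).mp (by exact_mod_cast h)
    have hle := Nat.le_of_dvd two_pos hdvd
    have := hp.two_le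
    obtain ⟨m, hm⟩ := hodd
    omega
  obtain ⟨m, rfl⟩ := hodd
  have hm : 1 ≤ m := by have := hp.two_le; omega
  set M : Matrix (Fin (2 * m + 1)) (Fin (2 * m + 1)) F := Matrix.of fun i j =>
    if (i.val = 2 * m + 1 - 2 ∧ j.val = 2 * m + 1 - 1) ∨
      (i.val = 2 * m + 1 - 1 ∧ j.val = 2 * m + 1 - 2) then t
    else if i.val + j.val = 2 * m + 1 - 3 then (-1 : F) else 0 with hM
  let a : Fin (2 * m + 1) → Fin (2 * m + 1) := fun k =>
    ⟨if k.val = 2 * m then m - 1 else if 2 * m - 2 ≤ k.val then 2 * m - 1 else k.val / 2,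
      by split_ifs <;> omega⟩
  let b : Fin (2 * m + 1) → Fin (2 * m + 1) := fun k =>
    ⟨if k.val = 2 * m then m - 1 else if 2 * m - 2 ≤ k.val then 2 * m
      else 2 * m - 2 - k.val / 2, by split_ifs <;> omega⟩
  let s : Fin (2 * m + 1) → F := fun k =>
    if k.val = 2 * m then 0
    else (if 2 * m - 2 ≤ k.val then -(2 * t)⁻¹ else 2⁻¹) * if Even k.val then 1 else -1
  set P : Matrix (Fin (2 * m + 1)) (Fin (2 * m + 1)) F :=
    Matrix.of fun r k => (if r = a k then 1 else 0) + if r = b k then s k else 0 with hP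
  have key : P.transpose * M * P =
      Matrix.diagonal fun i : Fin (2 * m + 1) => if Even i.val then (-1 : F) else 1 := by
    let c : Fin (2 * m + 1) → F := fun k => if k.val = 2 * m then -1
      else if 2 * m - 2 ≤ k.val then t else -1
    have haa (k l) : M (a k) (a l) = if k.val = 2 * m ∧ l.val = 2 * m then -1 else 0 := by
      simp only [hM, Matrix.of_apply, a]
      split_ifs <;> first | omega | rfl
    have hbb (k l) : M (b k) (b l) = if k.val = 2 * m ∧ l.val = 2 * m then -1 else 0 := by
      simp only [hM, Matrix.of_apply, b]
      split_ifs <;> first | omega | rfl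
    have hab (k l) : M (a k) (b l) = if k.val / 2 = l.val / 2 then c k else 0 := by
      simp only [hM, Matrix.of_apply, a, b, c]
      split_ifs <;> first | omega | rfl
    have hba (k l) : M (b k) (a l) = if k.val / 2 = l.val / 2 then c k else 0 := by
      simp only [hM, Matrix.of_apply, a, b, c]
      split_ifs <;> first | omega | rfl
    have hs_last (k) (hk : k.val = 2 * m) : s k = 0 := if_pos hk
    have hsc (k) (hk : k.val ≠ 2 * m) : s k * c k = if Even k.val then -2⁻¹ else 2⁻¹ := by
      simp only [s, c, if_neg hk]
      split_ifs <;> field_simp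
    have hc (k l : Fin (2 * m + 1)) (hkl : k.val / 2 = l.val / 2) : c k = c l := by
      simp only [c]
      split_ifs <;> first | omega | rfl
    ext k l
    rw [hP, transpose_mul_mul_apply_of_two_term_columns, Matrix.diagonal_apply,
      haa, hab, hba, hbb]
    by_cases hkl : k.val / 2 = l.val / 2
    · by_cases hk : k.val = 2 * m
      · obtain rfl : k = l := Fin.ext (by omega)
        simp [hk, hs_last]
      · have hl : l.val ≠ 2 * m := by omega
        have hck := hsc k hk
        have hcl := hsc l hl
        rw [← hc k l hkl] at hcl
        simp only [hkl, hk, false_and, if_true, if_false, hck, hcl, Fin.ext_iff, Nat.even_iff]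
        split_ifs <;> first | omega | (field_simp; ring)
    · have hne : k ≠ l := fun h => hkl (by rw [h])
      have hlast : ¬ (k.val = 2 * m ∧ l.val = 2 * m) := by omega
      simp [hkl, hne, hlast]
  refine ⟨P, ?_, key⟩
  have hdet := congrArg Matrix.det key
  rw [Matrix.det_mul, Matrix.det_mul, Matrix.det_diagonal] at hdet
  refine isUnit_iff_ne_zero.mpr fun h0 => ?_
  rw [h0, mul_zero] at hdet
  refine Finset.prod_ne_zero_iff.mpr (fun i _ => ?_) hdet.symm
  split_ifs <;> simp
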